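/- Let k be an algebraically closed field and let L be a field extension of k. Write PGL₂(L) for the quotient of GL₂(L) by its center (the scalar matrices), and let PGL₂(k) ⊆ PGL₂(L) denote the subgroup of classes of matrices with entries in k. Let G ⊆ PGL₂(L) be a subgroup such that every element of G is conjugate in PGL₂(L) to an element of PGL₂(k). Then G is conjugate in PGL₂(L) either to a subgroup of PGL₂(k), or to a subgroup of the image T in PGL₂(L) of the set of upper triangular matrices {[[a, P],[0, 1]] : a ∈ kˣ, P ∈ L}. -/

import Mathlib

/-- The subset `PGL₂(k)` of `PGL₂(L) = GL₂(L)/center`: classes of matrices all of whose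
entries lie in the subfield `k` (i.e. in the range of `algebraMap k L`). -/
def pglOfSubfield (k L : Type*) [Field k] [Field L] [Algebra k L] :
    Set (Matrix.GeneralLinearGroup (Fin 2) L ⧸
      Subgroup.center (Matrix.GeneralLinearGroup (Fin 2) L)) :=
  {x | ∃ M : Matrix.GeneralLinearGroup (Fin 2) L,
        (∀ i j, (M : Matrix (Fin 2) (Fin 2) L) i j ∈ Set.range (algebraMap k L)) ∧
        (QuotientGroup.mk M : Matrix.GeneralLinearGroup (Fin 2) L ⧸
            Subgroup.center (Matrix.GeneralLinearGroup (Fin 2) L)) = x}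

/-- The subset `T` of `PGL₂(L)`: the image of the upper triangular matrices
`[[a, P], [0, 1]]` with `a ∈ kˣ` and `P ∈ L`. -/
def pglTriangle (k L : Type*) [Field k] [Field L] [Algebra k L] :
    Set (Matrix.GeneralLinearGroup (Fin 2) L ⧸
      Subgroup.center (Matrix.GeneralLinearGroup (Fin 2) L)) :=
  {x | ∃ M : Matrix.GeneralLinearGroup (Fin 2) L,
        (∃ a : kˣ, (M : Matrix (Fin 2) (Fin 2) L) 0 0 = algebraMap k L (a : k)) ∧
        (M : Matrix (Fin 2) (Fin 2) L) 1 0 = 0 ∧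
        (M : Matrix (Fin 2) (Fin 2) L) 1 1 = 1 ∧
        (QuotientGroup.mk M : Matrix.GeneralLinearGroup (Fin 2) L ⧸
            Subgroup.center (Matrix.GeneralLinearGroup (Fin 2) L)) = x}

/-- conj formula -/
theorem h5_conj {L : Type*} [Field L] (p q r s : L) (hd : p * s - q * r ≠ 0) :
    ∃ P : Matrix.GeneralLinearGroup (Fin 2) L, ∀ M : Matrix.GeneralLinearGroup (Fin 2) L,
      ((P * M * P⁻¹ : Matrix.GeneralLinearGroup (Fin 2) L) : Matrix (Fin 2) (Fin 2) L) =
      (p * s - q * r)⁻¹ • !![(p * M 0 0 + q * M 1 0) * s - (p * M 0 1 + q * M 1 1) * r,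
        -(p * M 0 0 + q * M 1 0) * q + (p * M 0 1 + q * M 1 1) * p;
        (r * M 0 0 + s * M 1 0) * s - (r * M 0 1 + s * M 1 1) * r,
        -(r * M 0 0 + s * M 1 0) * q + (r * M 0 1 + s * M 1 1) * p] := by
  have hd' : (!![p, q; r, s] : Matrix (Fin 2) (Fin 2) L).det ≠ 0 := by
    simpa [Matrix.det_fin_two] using hd
  refine ⟨Matrix.GeneralLinearGroup.mkOfDetNeZero !![p, q; r, s] hd', fun M => ?_⟩
  have h1 : ((Matrix.GeneralLinearGroup.mkOfDetNeZero !![p, q; r, s] hd' : Matrix.GeneralLinearGroup (Fin 2) L) :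
      Matrix (Fin 2) (Fin 2) L) = !![p, q; r, s] := rfl
  rw [Units.val_mul, Units.val_mul, Matrix.coe_units_inv, h1, Matrix.inv_def, Matrix.mul_smul,
    Matrix.adjugate_fin_two_of, Matrix.det_fin_two_of, Ring.inverse_eq_inv']
  congr 1
  ext i j
  rw [Matrix.mul_apply, Fin.sum_univ_two, Matrix.mul_apply, Matrix.mul_apply, Fin.sum_univ_two,
    Fin.sum_univ_two]
  fin_cases i <;> fin_cases j <;> simp <;> ring

/-- The normal form dichotomy. -/
def h5_Good {L : Type*} [Field L] (K : Subfield L) (H : Subgroup (Matrix.GeneralLinearGroup (Fin 2) L)) : Prop :=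
  ∃ P : Matrix.GeneralLinearGroup (Fin 2) L, (∀ M ∈ H, ∀ i j, ((P * M * P⁻¹ : Matrix.GeneralLinearGroup (Fin 2) L) : Matrix (Fin 2) (Fin 2) L) i j ∈ K) ∨
    (∀ M ∈ H, ((P * M * P⁻¹ : Matrix.GeneralLinearGroup (Fin 2) L) : Matrix (Fin 2) (Fin 2) L) 1 0 = 0)

/-- Determinant one and trace in the subfield. -/
def h5_Hyp {L : Type*} [Field L] (K : Subfield L) (H : Subgroup (Matrix.GeneralLinearGroup (Fin 2) L)) : Prop :=
  ∀ M ∈ H, (M : Matrix (Fin 2) (Fin 2) L).det = 1 ∧ (M : Matrix (Fin 2) (Fin 2) L).trace ∈ K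

theorem h5_good_conj {L : Type*} [Field L] (K : Subfield L) (H : Subgroup (Matrix.GeneralLinearGroup (Fin 2) L))
    (P : Matrix.GeneralLinearGroup (Fin 2) L) (h : h5_Good K (H.map (MulAut.conj P).toMonoidHom)) : h5_Good K H := by
  obtain ⟨Q, hQ⟩ := h
  refine ⟨Q * P, ?_⟩
  have key : ∀ M : Matrix.GeneralLinearGroup (Fin 2) L, Q * P * M * (Q * P)⁻¹ = Q * (P * M * P⁻¹) * Q⁻¹ := by
    intro M; group
  refine hQ.imp (fun h M hM => ?_) (fun h M hM => ?_)
  · rw [key]; exact h _ ⟨M, hM, rfl⟩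
  · rw [key]; exact h _ ⟨M, hM, rfl⟩

theorem h5_det_conj {L : Type*} [Field L] (P M : Matrix.GeneralLinearGroup (Fin 2) L) :
    ((P * M * P⁻¹ : Matrix.GeneralLinearGroup (Fin 2) L) : Matrix (Fin 2) (Fin 2) L).det =
      (M : Matrix (Fin 2) (Fin 2) L).det := by
  rw [Units.val_mul, Units.val_mul]
  exact Matrix.det_units_conj P _

theorem h5_trace_conj {L : Type*} [Field L] (P M : Matrix.GeneralLinearGroup (Fin 2) L) :
    ((P * M * P⁻¹ : Matrix.GeneralLinearGroup (Fin 2) L) : Matrix (Fin 2) (Fin 2) L).trace =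
      (M : Matrix (Fin 2) (Fin 2) L).trace := by
  rw [Units.val_mul, Units.val_mul]
  exact Matrix.trace_units_conj P _

theorem h5_hyp_conj {L : Type*} [Field L] (K : Subfield L) (H : Subgroup (Matrix.GeneralLinearGroup (Fin 2) L))
    (P : Matrix.GeneralLinearGroup (Fin 2) L) (h : h5_Hyp K H) : h5_Hyp K (H.map (MulAut.conj P).toMonoidHom) := by
  rintro _ ⟨M, hM, rfl⟩
  have := h M hM
  simp only [MulEquiv.toMonoidHom_eq_coe, MonoidHom.coe_coe, MulAut.conj_apply]
  rw [h5_det_conj, h5_trace_conj]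
  exact this

/-- Diagonal case. -/
theorem h5_diag {L : Type*} [Field L] (K : Subfield L) (H : Subgroup (Matrix.GeneralLinearGroup (Fin 2) L))
    (h : h5_Hyp K H) (D : Matrix.GeneralLinearGroup (Fin 2) L) (hD : D ∈ H) (h01 : D 0 1 = 0) (h10 : D 1 0 = 0)
    (hne : D 0 0 ≠ D 1 1) (h0 : D 0 0 ∈ K) (h1 : D 1 1 ∈ K) : h5_Good K H := by
  have hd : ∀ N ∈ H, N 0 0 ∈ K ∧ N 1 1 ∈ K := by
    intro N hN
    have t1 := (h N hN).2
    have t2 := (h _ (H.mul_mem hD hN)).2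
    rw [Matrix.trace_fin_two] at t1 t2
    rw [Units.val_mul, Matrix.mul_apply, Matrix.mul_apply, Fin.sum_univ_two, Fin.sum_univ_two,
      h01, h10] at t2
    have hs : D 0 0 - D 1 1 ≠ 0 := sub_ne_zero.2 hne
    constructor
    · have e : N 0 0 = ((D 0 0 * N 0 0 + 0 * N 1 0 + (0 * N 0 1 + D 1 1 * N 1 1))
        - D 1 1 * (N 0 0 + N 1 1)) / (D 0 0 - D 1 1) := by
        field_simp; ring
      rw [e]
      exact K.div_mem (K.sub_mem t2 (K.mul_mem h1 t1)) (K.sub_mem h0 h1)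
    · have e : N 1 1 = (D 0 0 * (N 0 0 + N 1 1) - (D 0 0 * N 0 0 + 0 * N 1 0 + (0 * N 0 1 + D 1 1 * N 1 1)))
         / (D 0 0 - D 1 1) := by
        field_simp; ring
      rw [e]
      exact K.div_mem (K.sub_mem (K.mul_mem h0 t1) t2) (K.sub_mem h0 h1)
  have hbc : ∀ N ∈ H, ∀ N' ∈ H, N 0 1 * N' 1 0 ∈ K := by
    intro N hN N' hN'
    have t := (hd _ (H.mul_mem hN hN')).1
    rw [Units.val_mul, Matrix.mul_apply, Fin.sum_univ_two] at t
    have e : N 0 1 * N' 1 0 = (N 0 0 * N' 0 0 + N 0 1 * N' 1 0) - N 0 0 * N' 0 0 := by ring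
    rw [e]
    exact K.sub_mem t (K.mul_mem (hd N hN).1 (hd N' hN').1)
  by_cases hc : ∀ N ∈ H, N 1 0 = 0
  · exact ⟨1, Or.inr (fun M hM => by simpa using hc M hM)⟩
  by_cases hb : ∀ N ∈ H, N 0 1 = 0
  · obtain ⟨P, hP⟩ := h5_conj (0 : L) 1 1 0 (by simp)
    refine ⟨P, Or.inr (fun M hM => ?_)⟩
    have := hb M hM
    rw [hP]
    simp [this]
  push Not at hc hb
  obtain ⟨C, hC, hC0⟩ := hc
  obtain ⟨B, hB, hB0⟩ := hb
  obtain ⟨P, hP⟩ := h5_conj (C 1 0) 0 0 1 (by simpa using hC0)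
  refine ⟨P, Or.inl (fun M hM => ?_)⟩
  have e1 := hd M hM
  have e2 := hbc M hM C hC
  have e3 := hbc B hB M hM
  have e4 := hbc B hB C hC
  have e5 : M 1 0 / C 1 0 ∈ K := by
    have e : M 1 0 / C 1 0 = (B 0 1 * M 1 0) / (B 0 1 * C 1 0) := by field_simp
    rw [e]; exact K.div_mem e3 e4
  rw [hP]
  intro i j
  fin_cases i <;> fin_cases j
  · convert e1.1 using 1; simp; field_simp
  · convert e2 using 1; simp; field_simp
  · convert e5 using 1; simp; field_simp
  · convert e1.2 using 1; simp; field_simp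

/-- Triangularization. -/
theorem h5_tri {L : Type*} [Field L] (M : Matrix.GeneralLinearGroup (Fin 2) L)
    (hdet : (M : Matrix (Fin 2) (Fin 2) L).det = 1) (r : L)
    (hr : r * r - (M : Matrix (Fin 2) (Fin 2) L).trace * r + 1 = 0) :
    ∃ P : Matrix.GeneralLinearGroup (Fin 2) L, (P * M * P⁻¹ : Matrix.GeneralLinearGroup (Fin 2) L) 1 0 = 0 := by
  by_cases hc : M 1 0 = 0
  · exact ⟨1, by simpa using hc⟩
  obtain ⟨P, hP⟩ := h5_conj 0 (-1) (-(M 1 0)) (r - M 1 1) (by simpa using hc)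
  refine ⟨P, ?_⟩
  rw [hP]
  rw [Matrix.det_fin_two] at hdet
  rw [Matrix.trace_fin_two] at hr
  simp
  right
  linear_combination (M 1 0) * hr + (M 1 0) * hdet

theorem h5_core {L : Type*} [Field L] (K : Subfield L) (H : Subgroup (Matrix.GeneralLinearGroup (Fin 2) L))
    (hK : ∀ t ∈ K, ∃ r ∈ K, r * r - t * r + 1 = 0) (h : h5_Hyp K H) : h5_Good K H := by
  by_cases hA : ∃ M ∈ H, (M : Matrix (Fin 2) (Fin 2) L).trace * (M : Matrix (Fin 2) (Fin 2) L).trace ≠ 4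
  · obtain ⟨M, hM, ht⟩ := hA
    obtain ⟨r, hrK, hr⟩ := hK _ (h M hM).2
    obtain ⟨P, hP⟩ := h5_tri M (h M hM).1 r hr
    apply h5_good_conj K H P
    have h' := h5_hyp_conj K H P h
    have hM' : P * M * P⁻¹ ∈ H.map (MulAut.conj P).toMonoidHom := ⟨M, hM, rfl⟩
    rw [← h5_trace_conj P] at hr ht
    generalize H.map (MulAut.conj P).toMonoidHom = H' at *
    generalize P * M * P⁻¹ = N at *
    have hN := h' N hM'
    rw [Matrix.det_fin_two, Matrix.trace_fin_two, hP] at hN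
    rw [Matrix.trace_fin_two] at hr ht
    obtain ⟨hdet, htr⟩ := hN
    have hne : N 0 0 - N 1 1 ≠ 0 := by
      intro h0
      apply ht
      linear_combination (N 0 0 - N 1 1) * h0 + 4 * hdet
    have hf : (r - N 0 0) * (r - N 1 1) = 0 := by linear_combination hr + hdet
    have hab : N 0 0 ∈ K ∧ N 1 1 ∈ K := by
      rcases mul_eq_zero.1 hf with h1 | h1
      · have e : N 0 0 = r := by linear_combination -h1
        refine ⟨e ▸ hrK, ?_⟩
        have := K.sub_mem htr hrK
        rwa [← e, add_sub_cancel_left] at this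
      · have e : N 1 1 = r := by linear_combination -h1
        refine ⟨?_, e ▸ hrK⟩
        have := K.sub_mem htr hrK
        rwa [← e, add_sub_cancel_right] at this
    obtain ⟨Q, hQ⟩ := h5_conj 1 (N 0 1 / (N 0 0 - N 1 1)) 0 1 (by simp)
    apply h5_good_conj K H' Q
    have e := hQ N
    have e00 : (Q * N * Q⁻¹ : Matrix.GeneralLinearGroup (Fin 2) L) 0 0 = N 0 0 := by
      rw [e]; simp [hP]
    have e11 : (Q * N * Q⁻¹ : Matrix.GeneralLinearGroup (Fin 2) L) 1 1 = N 1 1 := by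
      rw [e]; simp [hP]
    apply h5_diag K _ (h5_hyp_conj K H' Q h') (Q * N * Q⁻¹) ⟨N, hM', rfl⟩
    · rw [e]; simp [hP]; field_simp; ring
    · rw [e]; simp [hP]
    · rw [e00, e11]; exact sub_ne_zero.1 hne
    · rw [e00]; exact hab.1
    · rw [e11]; exact hab.2
  push Not at hA
  by_cases hc : ∀ N ∈ H, N 1 0 = 0
  · exact ⟨1, Or.inr (fun M hM => by simpa using hc M hM)⟩
  push Not at hc
  obtain ⟨M, hM, hM0⟩ := hc
  obtain ⟨r, hrK, hr⟩ := hK _ (h M hM).2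
  obtain ⟨P, hP⟩ := h5_tri M (h M hM).1 r hr
  refine ⟨P, Or.inr (fun N hN => ?_)⟩
  have tM := hA M hM
  have tN := hA N hN
  have tMN := hA _ (H.mul_mem hM hN)
  have tMMN := hA _ (H.mul_mem hM (H.mul_mem hM hN))
  have dM := (h M hM).1
  rw [← h5_det_conj P] at dM
  have e1 : P * (M * N) * P⁻¹ = (P * M * P⁻¹) * (P * N * P⁻¹) := by group
  have e2 : P * (M * (M * N)) * P⁻¹ = (P * M * P⁻¹) * ((P * M * P⁻¹) * (P * N * P⁻¹)) := by group
  rw [← h5_trace_conj P] at tM tN tMN tMMN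
  rw [e1] at tMN
  rw [e2] at tMMN
  have hns : (P * M * P⁻¹ : Matrix.GeneralLinearGroup (Fin 2) L) 0 1 = 0 → (P * M * P⁻¹ : Matrix.GeneralLinearGroup (Fin 2) L) 0 0 = (P * M * P⁻¹ : Matrix.GeneralLinearGroup (Fin 2) L) 1 1 → False := by
    intro h1 h2
    have e : ((P * M * P⁻¹ : Matrix.GeneralLinearGroup (Fin 2) L) : Matrix (Fin 2) (Fin 2) L) =
      (P * M * P⁻¹ : Matrix.GeneralLinearGroup (Fin 2) L) 0 0 • (1 : Matrix (Fin 2) (Fin 2) L) := by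
      ext i j
      fin_cases i <;> fin_cases j <;> simp [h1, hP, ← h2, -Units.val_mul]
    generalize (P * M * P⁻¹ : Matrix.GeneralLinearGroup (Fin 2) L) 0 0 = a at e
    have e' : (M : Matrix (Fin 2) (Fin 2) L) = a • (1 : Matrix (Fin 2) (Fin 2) L) := by
      have : M = P⁻¹ * (P * M * P⁻¹) * P := by group
      rw [this, Units.val_mul, Units.val_mul, e]
      simp [← Units.val_mul]
    apply hM0
    rw [e']; simp
  generalize P * M * P⁻¹ = A at *
  generalize P * N * P⁻¹ = B at *
  simp only [Units.val_mul, Matrix.trace_fin_two, Matrix.det_fin_two, Matrix.mul_apply,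
    Fin.sum_univ_two, hP] at *
  have h0 : A 0 0 = A 1 1 := by
    have : (A 0 0 - A 1 1) * (A 0 0 - A 1 1) = 0 := by linear_combination tM - 4 * dM
    exact sub_eq_zero.1 (mul_self_eq_zero.1 this)
  have hb : A 0 1 ≠ 0 := fun h1 => hns h1 h0
  rw [← h0] at tMN tMMN dM
  by_contra hB
  have hx : A 0 0 * A 0 1 * B 1 0 ≠ 0 := by
    refine mul_ne_zero (mul_ne_zero ?_ hb) hB
    intro h3; rw [h3] at dM; simp at dM
  have ha : A 0 0 * A 0 0 = 1 := by linear_combination dM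
  generalize hxx : A 0 0 * A 0 1 * B 1 0 = x at *
  generalize htt : B 0 0 + B 1 1 = t at *
  have f1 : (t + x) * (t + x) = 4 := by
    subst hxx htt
    linear_combination tMN + (A 0 1 ^ 2 * B 1 0 ^ 2 - (B 0 0 + B 1 1) ^ 2) * ha
  have f2 : (t + 2 * x) * (t + 2 * x) = 4 := by
    subst hxx htt
    linear_combination tMMN + (- (B 0 0 + B 1 1)^2 * (A 0 0 ^2 +1) - 4 * (B 0 0 + B 1 1) * A 0 0 * A 0 1 * B 1 0 ) * ha
  have g1 : 2 * t + x = 0 := by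
    apply mul_left_cancel₀ hx; linear_combination f1 - tN
  have g2 : 4 * (t + x) = 0 := by
    apply mul_left_cancel₀ hx; linear_combination f2 - tN
  have g3 : 2 * x = 0 := by linear_combination g2 - 2 * g1
  rcases mul_eq_zero.1 g3 with h2 | h2
  · apply hx; linear_combination g1 - t * h2
  · exact hx h2

theorem h5_center {L : Type*} [Field L] (M N : Matrix.GeneralLinearGroup (Fin 2) L)
    (h : (QuotientGroup.mk M : Matrix.GeneralLinearGroup (Fin 2) L ⧸ Subgroup.center (Matrix.GeneralLinearGroup (Fin 2) L)) = QuotientGroup.mk N) :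
    ∃ z : L, (N : Matrix (Fin 2) (Fin 2) L) = z • (M : Matrix (Fin 2) (Fin 2) L) := by
  rw [QuotientGroup.eq, Matrix.GeneralLinearGroup.mem_center_iff_val_mem_range_scalar] at h
  obtain ⟨z, hz⟩ := h
  refine ⟨z, ?_⟩
  have e : N = M * (M⁻¹ * N) := by group
  rw [e, Units.val_mul, ← hz]
  rw [Matrix.scalar_apply, ← Matrix.smul_one_eq_diagonal, Matrix.mul_smul, Matrix.mul_one]

theorem h5_center' {L : Type*} [Field L] (M N : Matrix.GeneralLinearGroup (Fin 2) L) (z : L)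
    (h : (N : Matrix (Fin 2) (Fin 2) L) = z • (M : Matrix (Fin 2) (Fin 2) L)) :
    (QuotientGroup.mk M : Matrix.GeneralLinearGroup (Fin 2) L ⧸ Subgroup.center (Matrix.GeneralLinearGroup (Fin 2) L)) = QuotientGroup.mk N := by
  rw [QuotientGroup.eq, Subgroup.mem_center_iff]
  have e : ((M⁻¹ * N : Matrix.GeneralLinearGroup (Fin 2) L) : Matrix (Fin 2) (Fin 2) L) = z • 1 := by
    rw [Units.val_mul, h, Matrix.mul_smul, ← Units.val_mul]; simp
  intro g
  ext1
  rw [Units.val_mul g, Units.val_mul (M⁻¹ * N) g, e]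
  simp

/-- if every element of a subgroup `G ⊆ PGL₂(L)` is conjugate in `PGL₂(L)` to
an element of `PGL₂(k)` (`k` algebraically closed), then `G` is conjugate either to a
subgroup of `PGL₂(k)` or to a subgroup of the triangular group `T`. -/
theorem stmt_5 (k L : Type*) [Field k] [IsAlgClosed k] [Field L] [Algebra k L]
    (G : Subgroup (Matrix.GeneralLinearGroup (Fin 2) L ⧸
      Subgroup.center (Matrix.GeneralLinearGroup (Fin 2) L)))
    (hG : ∀ x ∈ G, ∃ h : Matrix.GeneralLinearGroup (Fin 2) L ⧸
        Subgroup.center (Matrix.GeneralLinearGroup (Fin 2) L),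
        h * x * h⁻¹ ∈ pglOfSubfield k L) :
    (∃ g : Matrix.GeneralLinearGroup (Fin 2) L ⧸
        Subgroup.center (Matrix.GeneralLinearGroup (Fin 2) L),
        ∀ x ∈ G, g * x * g⁻¹ ∈ pglOfSubfield k L) ∨
    (∃ g : Matrix.GeneralLinearGroup (Fin 2) L ⧸
        Subgroup.center (Matrix.GeneralLinearGroup (Fin 2) L),
        ∀ x ∈ G, g * x * g⁻¹ ∈ pglTriangle k L) := by
  set K : Subfield L := (algebraMap k L).fieldRange with hKdef
  have hKr : ∀ x, x ∈ K ↔ x ∈ Set.range (algebraMap k L) := fun x => Iff.rfl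
  have hK : ∀ t ∈ K, ∃ r ∈ K, r * r - t * r + 1 = 0 := by
    rintro _ ⟨t, rfl⟩
    obtain ⟨r, hr⟩ := IsAlgClosed.exists_root
      (Polynomial.X ^ 2 - Polynomial.C t * Polynomial.X + Polynomial.C 1 : Polynomial k) (by
        have : (Polynomial.X ^ 2 - Polynomial.C t * Polynomial.X + Polynomial.C 1 :
          Polynomial k).degree = 2 := by compute_degree!
        rw [this]; decide)
    refine ⟨algebraMap k L r, ⟨r, rfl⟩, ?_⟩
    simp only [Polynomial.IsRoot.def, Polynomial.eval_add, Polynomial.eval_sub,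
      Polynomial.eval_pow, Polynomial.eval_X, Polynomial.eval_mul, Polynomial.eval_C] at hr
    rw [← map_mul, ← map_mul, ← map_sub, ← map_one (algebraMap k L), ← map_add,
      ← map_zero (algebraMap k L)]
    congr 1
    linear_combination hr
  have hS : ∀ t ∈ K, ∃ r ∈ K, t = r * r := by
    rintro _ ⟨t, rfl⟩
    obtain ⟨r, hr⟩ := IsAlgClosed.exists_eq_mul_self t
    exact ⟨algebraMap k L r, ⟨r, rfl⟩, by rw [hr, map_mul]⟩
  -- every element of `G` has a representative of determinant one
  have hrep : ∀ x ∈ G, ∃ M : Matrix.GeneralLinearGroup (Fin 2) L, QuotientGroup.mk M = x ∧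
      (M : Matrix (Fin 2) (Fin 2) L).det = 1 ∧ (M : Matrix (Fin 2) (Fin 2) L).trace ∈ K := by
    intro x hx
    obtain ⟨h, N, hN, hNx⟩ := hG x hx
    obtain ⟨h, rfl⟩ := QuotientGroup.mk_surjective h
    have hdK : (N : Matrix (Fin 2) (Fin 2) L).det ∈ K := by
      rw [Matrix.det_fin_two]
      exact K.sub_mem (K.mul_mem (hN _ _) (hN _ _)) (K.mul_mem (hN _ _) (hN _ _))
    have htK : (N : Matrix (Fin 2) (Fin 2) L).trace ∈ K := by
      rw [Matrix.trace_fin_two]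
      exact K.add_mem (hN _ _) (hN _ _)
    have hd0 : (N : Matrix (Fin 2) (Fin 2) L).det ≠ 0 := N.det_ne_zero
    obtain ⟨s, hsK, hs⟩ := hS _ hdK
    have hs0 : s ≠ 0 := by
      rintro rfl; exact hd0 (by simpa using hs)
    have hdet1 : (s⁻¹ • (N : Matrix (Fin 2) (Fin 2) L)).det = 1 := by
      rw [Matrix.det_smul, hs]; simp; field_simp
    set N' : Matrix.GeneralLinearGroup (Fin 2) L := Matrix.GeneralLinearGroup.mkOfDetNeZero
      (s⁻¹ • (N : Matrix (Fin 2) (Fin 2) L)) (by rw [hdet1]; exact one_ne_zero) with hN'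
    have eN' : (N' : Matrix (Fin 2) (Fin 2) L) = s⁻¹ • (N : Matrix (Fin 2) (Fin 2) L) := rfl
    refine ⟨h⁻¹ * N' * (h⁻¹)⁻¹, ?_, ?_, ?_⟩
    · rw [QuotientGroup.mk_mul, QuotientGroup.mk_mul, ← h5_center' N N' s⁻¹ eN', hNx,
        inv_inv, QuotientGroup.mk_inv]
      group
    · rw [h5_det_conj, eN', hdet1]
    · rw [h5_trace_conj, eN', Matrix.trace_smul]
      exact K.mul_mem (K.inv_mem hsK) htK
  set H : Subgroup (Matrix.GeneralLinearGroup (Fin 2) L) := G.comap (QuotientGroup.mk' _) ⊓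
    (Matrix.GeneralLinearGroup.det (n := Fin 2) (R := L)).ker with hH
  have memH : ∀ M : Matrix.GeneralLinearGroup (Fin 2) L, M ∈ H ↔ (QuotientGroup.mk M ∈ G ∧
      (M : Matrix (Fin 2) (Fin 2) L).det = 1) := by
    intro M
    rw [hH, Subgroup.mem_inf, MonoidHom.mem_ker, Units.ext_iff]
    rfl
  have hyp : h5_Hyp K H := by
    intro M hM
    obtain ⟨hM1, hM2⟩ := (memH M).1 hM
    refine ⟨hM2, ?_⟩
    obtain ⟨N, hN, hNd, hNt⟩ := hrep _ hM1
    obtain ⟨z, hz⟩ := h5_center N M hN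
    rw [hz, Matrix.det_smul, hNd] at hM2
    have hz1 : z ∈ K := by
      have : z ^ 2 = 1 := by simpa using hM2
      rcases eq_or_eq_neg_of_sq_eq_sq z 1 (by simpa using this) with h | h
      · rw [h]; exact K.one_mem
      · rw [h]; exact K.neg_mem K.one_mem
    rw [hz, Matrix.trace_smul]
    exact K.mul_mem hz1 hNt
  obtain ⟨P, hP | hP⟩ := h5_core K H hK hyp
  · left
    refine ⟨QuotientGroup.mk P, fun x hx => ?_⟩
    obtain ⟨M, rfl, hMd, hMt⟩ := hrep x hx
    exact ⟨P * M * P⁻¹, hP M ((memH M).2 ⟨hx, hMd⟩), rfl⟩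
  · right
    refine ⟨QuotientGroup.mk P, fun x hx => ?_⟩
    obtain ⟨M, rfl, hMd, hMt⟩ := hrep x hx
    have h10 := hP M ((memH M).2 ⟨hx, hMd⟩)
    have hx' : (QuotientGroup.mk P * QuotientGroup.mk M * (QuotientGroup.mk P)⁻¹ :
        Matrix.GeneralLinearGroup (Fin 2) L ⧸ Subgroup.center (Matrix.GeneralLinearGroup (Fin 2) L)) = QuotientGroup.mk (P * M * P⁻¹) := rfl
    rw [hx']
    rw [← h5_det_conj P] at hMd
    rw [← h5_trace_conj P] at hMt
    generalize P * M * P⁻¹ = A at *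
    rw [Matrix.det_fin_two, h10] at hMd
    rw [Matrix.trace_fin_two] at hMt
    obtain ⟨r, hrK, hr⟩ := hK _ hMt
    have hf : (r - A 0 0) * (r - A 1 1) = 0 := by linear_combination hr + hMd
    have ha : A 0 0 ∈ K := by
      rcases mul_eq_zero.1 hf with h1 | h1
      · rw [← sub_eq_zero.1 h1]; exact hrK
      · have := K.sub_mem hMt hrK
        rwa [sub_eq_zero.1 h1, add_sub_cancel_right] at this
    obtain ⟨a, haa⟩ := ha
    have h00 : A 0 0 ≠ 0 := by
      intro h; rw [h] at hMd; simp at hMd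
    have ha0 : a ≠ 0 := by
      rintro rfl; exact h00 (by rw [← haa, map_zero])
    have hdet : (A 0 0 • (A : Matrix (Fin 2) (Fin 2) L)).det ≠ 0 := by
      rw [Matrix.det_smul]
      exact mul_ne_zero (pow_ne_zero _ h00) A.det_ne_zero
    refine ⟨Matrix.GeneralLinearGroup.mkOfDetNeZero _ hdet, ⟨Units.mk0 (a * a) (mul_ne_zero ha0 ha0), ?_⟩,
      ?_, ?_, (h5_center' A _ (A 0 0) rfl).symm⟩
    · change A 0 0 * A 0 0 = _
      rw [Units.val_mk0, map_mul, haa]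
    · change A 0 0 * A 1 0 = 0
      rw [h10, mul_zero]
    · change A 0 0 * A 1 1 = 1
      linear_combination hMd
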